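/- arXiv:1909.07949 — 12 statements merged into one kernel-verified Lean document; each statement's English description precedes it below -/
import Mathlib

section
/- Suppose the generalized bathtub model is in a stationary state: K(t,x) = λ·Φ(x) with constant λ > 0, Φ differentiable with φ(x) = −Φ′(x), Φ(0) = 1, Φ(x) → 0 as x → ∞, φ(0) > 0, constant speed v = V(λ/L) > 0, and the K-model equation reduces to λ·V(λ/L)·φ(x) = f(t)·Φ̃(t,x) for all t ≥ 0, x ≥ 0, where Φ̃(t,0) = 1. Then: (a) the in-flux is constant, f(t) = f = L·Q(λ/L)·φ(0), where Q(ρ) = ρ·V(ρ); (b) the entering-trip distance distribution is time-independent, Φ̃(t,x) = φ(x)/φ(0) for all t, x; and (c) the average entering-trip distance is constant, B̃(t) = ∫₀^∞ Φ̃(t,x) dx = 1/φ(0). -/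
open MeasureTheory Set Filter

/-- in a stationary state of the generalized bathtub model, with
`φ(x) = -Φ'(x)` and stationary K-model equation `λ·V(λ/L)·φ(x) = f(t)·Φ̃(t,x)`,
the in-flux is constant `f = L·Q(λ/L)·φ(0)` with `Q(ρ) = ρ·V(ρ)`, the entering-trip
distance distribution is time-independent `Φ̃(t,x) = φ(x)/φ(0)`, and the average
entering-trip distance is `B̃(t) = 1/φ(0)`. -/
theorem stationary_influx_and_distribution
    (L lam : ℝ) (hL : 0 < L) (hlam : 0 < lam)
    (V : ℝ → ℝ) (Φ : ℝ → ℝ) (f : ℝ → ℝ) (Φt : ℝ → ℝ → ℝ) (Bt : ℝ → ℝ)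
    (hΦdiff : Differentiable ℝ Φ)
    (hΦ0 : Φ 0 = 1)
    (hΦlim : Tendsto Φ atTop (nhds 0))
    (hφ0pos : 0 < -deriv Φ 0)
    (hvpos : 0 < V (lam / L))
    (hφint : IntegrableOn (deriv Φ) (Ici 0))
    (hstat : ∀ t ≥ (0:ℝ), ∀ x ≥ (0:ℝ),
      lam * V (lam / L) * (-deriv Φ x) = f t * Φt t x)
    (hΦt0 : ∀ t ≥ (0:ℝ), Φt t 0 = 1)
    (hBt : ∀ t ≥ (0:ℝ), Bt t = ∫ x in Ici (0:ℝ), Φt t x) :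
    (∀ t ≥ (0:ℝ), f t = L * ((lam / L) * V (lam / L)) * (-deriv Φ 0)) ∧
    (∀ t ≥ (0:ℝ), ∀ x ≥ (0:ℝ), Φt t x = (-deriv Φ x) / (-deriv Φ 0)) ∧
    (∀ t ≥ (0:ℝ), Bt t = 1 / (-deriv Φ 0)) := by
  have hf : ∀ t ≥ (0 : ℝ), f t = lam * V (lam / L) * (-deriv Φ 0) := fun t ht => by
    rw [hstat t ht 0 le_rfl, hΦt0 t ht, mul_one]
  have hΦt : ∀ t ≥ (0 : ℝ), ∀ x ≥ (0 : ℝ), Φt t x = (-deriv Φ x) / (-deriv Φ 0) := by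
    intro t ht x hx
    have h := hstat t ht x hx
    rw [hf t ht, mul_assoc (lam * V (lam / L))] at h
    rw [eq_div_iff hφ0pos.ne', mul_comm]
    exact (mul_left_cancel₀ (mul_pos hlam hvpos).ne' h).symm
  refine ⟨fun t ht => ?_, hΦt, fun t ht => ?_⟩
  · rw [hf t ht, ← mul_assoc L, mul_div_cancel₀ lam hL.ne']
  · have hint : ∫ x in Ioi (0 : ℝ), deriv Φ x = 0 - Φ 0 :=
      integral_Ioi_of_hasDerivAt_of_tendsto' (fun x _ => (hΦdiff x).hasDerivAt)
        (hφint.mono_set Ioi_subset_Ici_self) hΦlim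
    rw [hBt t ht, setIntegral_congr_fun measurableSet_Ici (hΦt t ht), integral_div,
      integral_neg, integral_Ici_eq_integral_Ioi, hint, hΦ0, zero_sub, neg_neg]
end

section
/- Let λ : [0,∞) → (0,∞) be differentiable, v : [0,∞) → (0,∞), f : [0,∞) → (0,∞), B > 0, and suppose K(t,x) = λ(t)·exp(−x/B) satisfies the K-model PDE ∂K/∂t(t,x) − v(t)·∂K/∂x(t,x) = f(t)·Φ̃(t,x) for all t ≥ 0, x ≥ 0, where Φ̃(t,0) = 1. Then Φ̃(t,x) = exp(−x/B) for all t ≥ 0 and x ≥ 0, and λ satisfies Vickrey's bathtub equation λ′(t) = f(t) − (1/B)·λ(t)·v(t). -/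
open MeasureTheory Set Filter

/-- if `K(t,x) = λ(t)·exp(-x/B)` satisfies the K-model PDE
`∂K/∂t - v(t)·∂K/∂x = f(t)·Φ̃(t,x)` with `Φ̃(t,0) = 1`, then the entering
distribution is `Φ̃(t,x) = exp(-x/B)` and `λ` satisfies Vickrey's bathtub
equation `λ'(t) = f(t) - (1/B)·λ(t)·v(t)`. -/
theorem exponential_remaining_implies_vickrey
    (lam v f : ℝ → ℝ) (Φt : ℝ → ℝ → ℝ) (B : ℝ) (hB : 0 < B)
    (hlam_pos : ∀ t ≥ (0:ℝ), 0 < lam t)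
    (hlam_diff : ∀ t ≥ (0:ℝ), DifferentiableAt ℝ lam t)
    (hv_pos : ∀ t ≥ (0:ℝ), 0 < v t)
    (hf_pos : ∀ t ≥ (0:ℝ), 0 < f t)
    (hΦt0 : ∀ t ≥ (0:ℝ), Φt t 0 = 1)
    (hPDE : ∀ t ≥ (0:ℝ), ∀ x ≥ (0:ℝ),
      deriv (fun s => lam s * Real.exp (-x / B)) t
        - v t * deriv (fun y => lam t * Real.exp (-y / B)) x = f t * Φt t x) :
    (∀ t ≥ (0:ℝ), ∀ x ≥ (0:ℝ), Φt t x = Real.exp (-x / B)) ∧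
    (∀ t ≥ (0:ℝ), deriv lam t = f t - 1 / B * lam t * v t) := by
  have hdy : ∀ t x : ℝ, deriv (fun y => lam t * Real.exp (-y / B)) x
      = lam t * (Real.exp (-x / B) * (-1 / B)) := fun t x =>
    ((((hasDerivAt_id x).neg.div_const B).exp).const_mul (lam t)).deriv
  have hpde : ∀ t ≥ (0:ℝ), ∀ x ≥ (0:ℝ),
      (deriv lam t + 1 / B * lam t * v t) * Real.exp (-x / B) = f t * Φt t x := by
    intro t ht x hx
    rw [← hPDE t ht x hx, hdy, deriv_mul_const (hlam_diff t ht)]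
    ring
  have hvick : ∀ t ≥ (0:ℝ), deriv lam t + 1 / B * lam t * v t = f t := by
    intro t ht
    simpa [hΦt0 t ht] using hpde t ht 0 le_rfl
  refine ⟨fun t ht x hx => ?_, fun t ht => eq_sub_of_add_eq (hvick t ht)⟩
  have h := hpde t ht x hx
  rw [hvick t ht] at h
  exact (mul_left_cancel₀ (hf_pos t ht).ne' h).symm
end

section
/- Let λ : [0,∞) → (0,∞) be differentiable, v : [0,∞) → (0,∞), f : [0,∞) → ℝ, and let Φ : [0,∞) → ℝ be differentiable with Φ(0) = 1. Suppose K(t,x) = λ(t)·Φ(x) satisfies the K-model PDE with time-independent and equal trip-distance distributions, i.e. λ′(t)·Φ(x) − v(t)·λ(t)·Φ′(x) = f(t)·Φ(x) for all t ≥ 0 and x ≥ 0. Then Φ(x) = exp(−φ₀·x) for all x ≥ 0, where φ₀ = −Φ′(0); i.e., the common time-independent distribution must be negative exponential. -/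
open MeasureTheory Set Filter

/-- A solution of `y' = c * y` on `[0, ∞)` is `y 0 * exp (c * x)`. -/
theorem eq_mul_exp_of_deriv_eq_mul {y : ℝ → ℝ} {c : ℝ} (hy : Differentiable ℝ y)
    (h : ∀ x ≥ (0 : ℝ), deriv y x = c * y x) :
    ∀ x ≥ (0 : ℝ), y x = y 0 * Real.exp (c * x) := by
  intro x hx
  have hderiv : ∀ z, HasDerivAt (fun s => y s * Real.exp (-(c * s)))
      (deriv y z * Real.exp (-(c * z)) + y z * (Real.exp (-(c * z)) * -(c * 1))) z := fun z =>
    (hy z).hasDerivAt.mul ((hasDerivAt_id z).const_mul c).neg.exp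
  have hconst := constant_of_has_deriv_right_zero (a := 0) (b := x)
    (fun z _ => (hderiv z).continuousAt.continuousWithinAt)
    (fun z hz => by
      have hz' := hderiv z
      rw [h z hz.1, show c * y z * Real.exp (-(c * z)) +
        y z * (Real.exp (-(c * z)) * -(c * 1)) = 0 by ring] at hz'
      exact hz'.hasDerivWithinAt) x ⟨hx, le_rfl⟩
  simp only [mul_zero, neg_zero, Real.exp_zero, mul_one] at hconst
  rw [← hconst, mul_assoc, ← Real.exp_add, neg_add_cancel, Real.exp_zero, mul_one]

/-- if `K(t,x) = λ(t)·Φ(x)` satisfies the K-model with time-independent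
and equal trip-distance distributions, i.e. `λ'(t)·Φ(x) - v(t)·λ(t)·Φ'(x) = f(t)·Φ(x)`
for all `t ≥ 0`, `x ≥ 0`, then `Φ(x) = exp(-φ₀·x)` where `φ₀ = -Φ'(0)`. -/
theorem time_independent_equal_implies_exponential
    (lam v f : ℝ → ℝ) (Φ : ℝ → ℝ)
    (hlam_pos : ∀ t ≥ (0:ℝ), 0 < lam t)
    (hlam_diff : ∀ t ≥ (0:ℝ), DifferentiableAt ℝ lam t)
    (hv_pos : ∀ t ≥ (0:ℝ), 0 < v t)
    (hΦ_diff : Differentiable ℝ Φ) (hΦ0 : Φ 0 = 1)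
    (hPDE : ∀ t ≥ (0:ℝ), ∀ x ≥ (0:ℝ),
      deriv lam t * Φ x - v t * lam t * deriv Φ x = f t * Φ x) :
    ∀ x ≥ (0:ℝ), Φ x = Real.exp (-((-deriv Φ 0) * x)) := by
  have hpos : v 0 * lam 0 ≠ 0 := (mul_pos (hv_pos 0 le_rfl) (hlam_pos 0 le_rfl)).ne'
  have hode : ∀ x ≥ (0 : ℝ), deriv Φ x = deriv Φ 0 * Φ x := by
    intro x hx
    have h0 := hPDE 0 le_rfl 0 le_rfl
    rw [hΦ0] at h0
    apply mul_left_cancel₀ hpos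
    linear_combination Φ x * h0 - hPDE 0 le_rfl x hx
  intro x hx
  rw [eq_mul_exp_of_deriv_eq_mul hΦ_diff hode x hx, hΦ0, one_mul, neg_mul, neg_neg]
end

section
/- Let λ : [0,∞) → (0,∞) be differentiable, v : [0,∞) → (0,∞), f : [0,∞) → ℝ, and let Φ, Φ̃ : [0,∞) → ℝ be time-independent distributions with Φ differentiable, Φ(0) = Φ̃(0) = 1, Φ(x) → 0 as x → ∞, Φ′ integrable on [0,∞), and ∫₀^∞ Φ(x) dx = ∫₀^∞ Φ̃(x) dx = B ∈ (0,∞). Suppose λ′(t)·Φ(x) − v(t)·λ(t)·Φ′(x) = f(t)·Φ̃(x) for all t ≥ 0 and x ≥ 0 (the K-model with time-independent distributions). Then φ(0) := −Φ′(0) = 1/B; equivalently, the out-flux satisfies g(t) = (1/B)·λ(t)·v(t). -/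
open MeasureTheory Set Filter

/-- in the K-model with time-independent distributions
`λ'(t)·Φ(x) - v(t)·λ(t)·Φ'(x) = f(t)·Φ̃(x)`, if the average remaining distance and
the average entering-trip distance are both equal to the constant `B`
(`∫₀^∞ Φ = ∫₀^∞ Φ̃ = B`), then `φ(0) = -Φ'(0) = 1/B`; equivalently the out-flux is
`g(t) = (1/B)·λ(t)·v(t)`. -/
theorem equal_mean_distances_implies_outflux
    (lam v f : ℝ → ℝ) (Φ Φt : ℝ → ℝ) (B : ℝ) (hB : 0 < B)
    (hlam_pos : ∀ t ≥ (0:ℝ), 0 < lam t)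
    (hlam_diff : ∀ t ≥ (0:ℝ), DifferentiableAt ℝ lam t)
    (hv_pos : ∀ t ≥ (0:ℝ), 0 < v t)
    (hΦ_diff : Differentiable ℝ Φ)
    (hΦ0 : Φ 0 = 1) (hΦt0 : Φt 0 = 1)
    (hΦlim : Tendsto Φ atTop (nhds 0))
    (hΦ'int : IntegrableOn (deriv Φ) (Ici 0))
    (hΦint : IntegrableOn Φ (Ici 0)) (hΦtint : IntegrableOn Φt (Ici 0))
    (hΦB : (∫ x in Ici (0:ℝ), Φ x) = B)
    (hΦtB : (∫ x in Ici (0:ℝ), Φt x) = B)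
    (hPDE : ∀ t ≥ (0:ℝ), ∀ x ≥ (0:ℝ),
      deriv lam t * Φ x - v t * lam t * deriv Φ x = f t * Φt x) :
    -deriv Φ 0 = 1 / B ∧
    (∀ t ≥ (0:ℝ), (-deriv Φ 0) * lam t * v t = 1 / B * (lam t * v t)) := by
  have hΦ'_integral : (∫ x in Ici (0:ℝ), deriv Φ x) = -1 := by
    rw [integral_Ici_eq_integral_Ioi,
      integral_Ioi_of_hasDerivAt_of_tendsto' (fun x _ => (hΦ_diff x).hasDerivAt)
        (hΦ'int.mono_set Ioi_subset_Ici_self) hΦlim, hΦ0]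
    norm_num
  have hbalance : deriv lam 0 * B + v 0 * lam 0 = f 0 * B := by
    have h := setIntegral_congr_fun (μ := volume) measurableSet_Ici
      (fun x (hx : x ∈ Ici (0:ℝ)) => hPDE 0 le_rfl x hx)
    rw [integral_sub (hΦint.const_mul _) (hΦ'int.const_mul _), integral_const_mul,
      integral_const_mul, integral_const_mul, hΦB, hΦtB, hΦ'_integral] at h
    linarith
  have hboundary := hPDE 0 le_rfl 0 le_rfl
  rw [hΦ0, hΦt0] at hboundary
  have hflow : v 0 * lam 0 ≠ 0 := (mul_pos (hv_pos 0 le_rfl) (hlam_pos 0 le_rfl)).ne'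
  have hrate : -deriv Φ 0 = 1 / B := by
    rw [eq_div_iff hB.ne']
    apply mul_left_cancel₀ hflow
    linear_combination B * hboundary - hbalance
  exact ⟨hrate, fun t _ => by rw [hrate, mul_assoc]⟩
end

section
/- Let v, f : [0,∞) → ℝ be continuous, Φ̃ : [0,∞) × [0,∞) → ℝ be continuous, z(t) = ∫₀ᵗ v(s) ds, and let K : [0,∞) × [0,∞) → ℝ be continuously differentiable and satisfy the K-model PDE ∂K/∂t(t,x) − v(t)·∂K/∂x(t,x) = f(t)·Φ̃(t,x) for all t ≥ 0 and x ≥ 0, where v(t) ≥ 0. Then for all t ≥ 0 and x ≥ 0, K(t,x) = K(0, x + z(t)) + ∫₀ᵗ f(s)·Φ̃(s, x + z(t) − z(s)) ds (the integral form of the bathtub model); in particular, λ(t) = K(t,0) = K(0, z(t)) + ∫₀ᵗ f(s)·Φ̃(s, z(t) − z(s)) ds. -/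
open MeasureTheory Set Filter intervalIntegral

/-- Along a differentiable curve `s ↦ (s, g s)`, a differentiable function of two variables
has the total derivative `∂₁K + g' ∂₂K`. -/
theorem hasDerivAt_along_curve {K : ℝ → ℝ → ℝ} {g : ℝ → ℝ} {g' s : ℝ}
    (hK : DifferentiableAt ℝ (Function.uncurry K) (s, g s)) (hg : HasDerivAt g g' s) :
    HasDerivAt (fun r => K r (g r))
      (deriv (fun r => K r (g s)) s + g' * deriv (fun y => K s y) (g s)) s := by
  set L := fderiv ℝ (Function.uncurry K) (s, g s)
  have hL : HasFDerivAt (Function.uncurry K) L (s, g s) := hK.hasFDerivAt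
  have h₁ : HasDerivAt (fun r => K r (g s)) (L (1, 0)) s :=
    hL.comp_hasDerivAt (f := fun r => (r, g s)) s ((hasDerivAt_id s).prodMk (hasDerivAt_const s _))
  have h₂ : HasDerivAt (fun y => K s y) (L (0, 1)) (g s) :=
    hL.comp_hasDerivAt (f := fun y => (s, y)) (g s)
      ((hasDerivAt_const (g s) s).prodMk (hasDerivAt_id (g s)))
  have h : HasDerivAt (fun r => K r (g r)) (L (1, g')) s :=
    hL.comp_hasDerivAt (f := fun r => (r, g r)) s ((hasDerivAt_id s).prodMk hg)
  have hsplit : ((1, g') : ℝ × ℝ) = (1, 0) + g' • (0, 1) := by simp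
  rw [hsplit, map_add, map_smul, smul_eq_mul] at h
  rwa [h₁.deriv, h₂.deriv]

/-- the integral form of the generalized bathtub model. If `K` is
continuously differentiable and satisfies the K-model PDE
`∂K/∂t - v(t)·∂K/∂x = f(t)·Φ̃(t,x)` on `t ≥ 0`, `x ≥ 0` with `v ≥ 0`, then
`K(t,x) = K(0, x+z(t)) + ∫₀ᵗ f(s)·Φ̃(s, x+z(t)-z(s)) ds`, and in particular
`λ(t) = K(t,0) = K(0, z(t)) + ∫₀ᵗ f(s)·Φ̃(s, z(t)-z(s)) ds`. -/
theorem integral_bathtub_model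
    (v f : ℝ → ℝ) (Φt K : ℝ → ℝ → ℝ)
    (hv : Continuous v) (hvnn : ∀ t ≥ (0:ℝ), 0 ≤ v t) (hf : Continuous f)
    (hΦt : Continuous (Function.uncurry Φt))
    (z : ℝ → ℝ) (hz : ∀ t, z t = ∫ s in (0:ℝ)..t, v s)
    (hK : ContDiff ℝ 1 (Function.uncurry K))
    (hPDE : ∀ t ≥ (0:ℝ), ∀ x ≥ (0:ℝ),
      deriv (fun s => K s x) t - v t * deriv (fun y => K t y) x = f t * Φt t x) :
    (∀ t ≥ (0:ℝ), ∀ x ≥ (0:ℝ),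
      K t x = K 0 (x + z t) + ∫ s in (0:ℝ)..t, f s * Φt s (x + z t - z s)) ∧
    (∀ t ≥ (0:ℝ),
      K t 0 = K 0 (z t) + ∫ s in (0:ℝ)..t, f s * Φt s (z t - z s)) := by
  have hzd (s : ℝ) : HasDerivAt z (v s) s := by
    rw [funext hz]
    exact hv.integral_hasStrictDerivAt 0 s |>.hasDerivAt
  have hzc : Continuous z := continuous_iff_continuousAt.2 fun s => (hzd s).continuousAt
  have hz0 : z 0 = 0 := by simp [hz]
  have hmono : MonotoneOn z (Ici 0) :=
    monotoneOn_of_hasDerivWithinAt_nonneg (convex_Ici 0) hzc.continuousOn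
      (fun s _ => (hzd s).hasDerivWithinAt) (fun s hs => hvnn s (interior_subset hs))
  have main : ∀ t ≥ (0:ℝ), ∀ x ≥ (0:ℝ),
      K t x = K 0 (x + z t) + ∫ s in (0:ℝ)..t, f s * Φt s (x + z t - z s) := by
    intro t ht x hx
    have hderiv : ∀ s ∈ uIcc 0 t,
        HasDerivAt (fun r => K r (x + z t - z r)) (f s * Φt s (x + z t - z s)) s := by
      intro s hs
      rw [uIcc_of_le ht] at hs
      have hle : z s ≤ z t := hmono hs.1 ht hs.2
      rw [← hPDE s hs.1 (x + z t - z s) (by linarith), sub_eq_add_neg, ← neg_mul]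
      exact hasDerivAt_along_curve (hK.differentiable one_ne_zero _)
        ((hzd s).const_sub (x + z t))
    have hcont : Continuous fun s => f s * Φt s (x + z t - z s) :=
      hf.mul (hΦt.comp (continuous_id.prodMk (continuous_const.sub hzc)))
    rw [integral_eq_sub_of_hasDerivAt hderiv (hcont.intervalIntegrable 0 t)]
    simp [hz0]
  exact ⟨main, fun t ht => by simpa using main t ht 0 le_rfl⟩
end

section
/- Let K : [0,∞) × [0,∞) → ℝ be continuously differentiable and satisfy the K-model PDE ∂K/∂t(t,x) − v(t)·∂K/∂x(t,x) = f(t)·Φ̃(t,x) for all t ≥ 0, x ≥ 0, with v, f continuous. Assume for each t that K(t,·) is integrable on [0,∞), K(t,x) → 0 as x → ∞, B̃(t) = ∫₀^∞ Φ̃(t,x) dx is finite and continuous in t, and that for every compact time interval there is an integrable function of x dominating |∂K/∂t(t,x)| on that interval. Then the remaining trip-miles M(t) = ∫₀^∞ K(t,x) dx is differentiable with M′(t) = f(t)·B̃(t) − v(t)·K(t,0); equivalently, the conservation of trip-miles holds: M(t) = M(0) + ∫₀ᵗ f(s)·B̃(s) ds − ∫₀ᵗ λ(s)·v(s) ds,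 where λ(s) = K(s,0). -/
open MeasureTheory Set Filter intervalIntegral

/-- The partial derivative in the first variable of a `C¹` function of two variables. -/
theorem hasDerivAt_fst_of_contDiff {K : ℝ → ℝ → ℝ}
    (hK : ContDiff ℝ 1 (Function.uncurry K)) (t x : ℝ) :
    HasDerivAt (fun s => K s x) (fderiv ℝ (Function.uncurry K) (t, x) (1, 0)) t := by
  have h := ((hK.differentiable one_ne_zero) (t, x)).hasFDerivAt
  exact h.comp_hasDerivAt (f := fun s : ℝ => (s, x)) t
    ((hasDerivAt_id t).prodMk (hasDerivAt_const t x))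

/-- The partial derivative in the second variable of a `C¹` function of two variables. -/
theorem hasDerivAt_snd_of_contDiff {K : ℝ → ℝ → ℝ}
    (hK : ContDiff ℝ 1 (Function.uncurry K)) (t x : ℝ) :
    HasDerivAt (K t) (fderiv ℝ (Function.uncurry K) (t, x) (0, 1)) x := by
  have h := ((hK.differentiable one_ne_zero) (t, x)).hasFDerivAt
  exact h.comp_hasDerivAt (f := fun y : ℝ => (t, y)) x
    ((hasDerivAt_const x t).prodMk (hasDerivAt_id x))

/-- The first partial derivative of a `C¹` function is jointly continuous. -/
theorem continuous_deriv_fst_of_contDiff {K : ℝ → ℝ → ℝ}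
    (hK : ContDiff ℝ 1 (Function.uncurry K)) :
    Continuous fun p : ℝ × ℝ => deriv (fun s => K s p.2) p.1 := by
  have h : (fun p : ℝ × ℝ => deriv (fun s => K s p.2) p.1) =
      fun p => fderiv ℝ (Function.uncurry K) p (1, 0) :=
    funext fun p => (hasDerivAt_fst_of_contDiff hK p.1 p.2).deriv
  rw [h]
  exact (hK.continuous_fderiv one_ne_zero).clm_apply continuous_const

/-- If the first partial derivative of a `C¹` function is dominated on `[a, b]` by an integrable
function of the second variable, the increment of the integral over the half-line is the integral
of the integrated derivative. -/
theorem integral_sub_integral_eq_of_dominated {K : ℝ → ℝ → ℝ} {g : ℝ → ℝ} {a b : ℝ}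
    (hab : a ≤ b) (hK : ContDiff ℝ 1 (Function.uncurry K))
    (ha : IntegrableOn (K a) (Ici 0)) (hb : IntegrableOn (K b) (Ici 0))
    (hg : IntegrableOn g (Ici 0))
    (hbound : ∀ t ∈ Icc a b, ∀ x ≥ (0:ℝ), |deriv (fun s => K s x) t| ≤ g x) :
    (∫ x in Ici (0:ℝ), K b x) - (∫ x in Ici (0:ℝ), K a x) =
      ∫ s in a..b, ∫ x in Ici (0:ℝ), deriv (fun r => K r x) s := by
  have hcont := continuous_deriv_fst_of_contDiff hK
  have hprod : Integrable (Function.uncurry fun s x => deriv (fun r => K r x) s)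
      ((volume.restrict (Ioc a b)).prod (volume.restrict (Ici (0:ℝ)))) := by
    refine (hg.comp_snd (volume.restrict (Ioc a b))).mono' hcont.aestronglyMeasurable ?_
    rw [Measure.prod_restrict]
    filter_upwards [ae_restrict_mem (measurableSet_Ioc.prod measurableSet_Ici)] with p hp
    exact hbound p.1 (Ioc_subset_Icc_self hp.1) p.2 hp.2
  rw [integral_of_le hab, integral_integral_swap hprod, ← integral_sub hb ha]
  refine integral_congr_ae (Eventually.of_forall fun x => ?_)
  have hx : Continuous fun s => deriv (fun r => K r x) s :=
    hcont.comp (Continuous.prodMk_left x)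
  change K b x - K a x = ∫ s in Ioc a b, deriv (fun r => K r x) s
  rw [← integral_of_le hab, integral_deriv_eq_sub
    (fun s _ => (hasDerivAt_fst_of_contDiff hK s x).differentiableAt)
    (hx.intervalIntegrable a b)]

/-- A transport equation `u - c k' = w` with `u`, `w` integrable on the half-line and `k`
vanishing at infinity can be integrated. -/
theorem integral_eq_of_sub_mul_deriv_eq {u k w : ℝ → ℝ} {c : ℝ}
    (hk : Differentiable ℝ k) (hlim : Tendsto k atTop (nhds 0))
    (hu : IntegrableOn u (Ici 0)) (hw : IntegrableOn w (Ici 0))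
    (heq : ∀ x ≥ (0:ℝ), u x - c * deriv k x = w x) :
    ∫ x in Ici (0:ℝ), u x = (∫ x in Ici (0:ℝ), w x) - c * k 0 := by
  have hint : IntegrableOn (fun x => c * deriv k x) (Ioi 0) := by
    refine ((hu.sub hw).mono_set Ioi_subset_Ici_self).congr_fun (fun x hx => ?_) measurableSet_Ioi
    have := heq x (le_of_lt hx)
    simp only [Pi.sub_apply]
    linarith
  have hval : ∫ x in Ioi (0:ℝ), c * deriv k x = c * 0 - c * k 0 :=
    integral_Ioi_of_hasDerivAt_of_tendsto' (f := fun x => c * k x)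
      (fun x _ => (hk x).hasDerivAt.const_mul c) hint (hlim.const_mul c)
  rw [integral_Ici_eq_integral_Ioi, integral_Ici_eq_integral_Ioi]
  have hsum : ∫ x in Ioi (0:ℝ), u x = ∫ x in Ioi (0:ℝ), (w x + c * deriv k x) :=
    setIntegral_congr_fun measurableSet_Ioi fun x hx => by
      have := heq x (le_of_lt hx)
      linarith
  rw [hsum, integral_add (hw.mono_set Ioi_subset_Ici_self) hint, hval]
  ring

/-- The fundamental theorem of calculus on a half-line, up to and including its endpoint. -/
theorem hasDerivWithinAt_Ici_of_eq_add_integral {M h : ℝ → ℝ} {a : ℝ}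
    (hh : ContinuousOn h (Ici a)) (hM : ∀ t ≥ a, M t = M a + ∫ s in a..t, h s)
    {t : ℝ} (ht : a ≤ t) : HasDerivWithinAt M (h t) (Ici a) t := by
  have hc : Continuous fun s => h (max a s) :=
    hh.comp_continuous (by fun_prop) fun s => le_max_left a s
  have hd := ((hc.integral_hasStrictDerivAt a t).hasDerivAt.const_add (M a)).hasDerivWithinAt
    (s := Ici a)
  rw [max_eq_right ht] at hd
  have heq : ∀ r ∈ Ici a, M r = M a + ∫ s in a..r, h (max a s) := fun r hr => by
    rw [hM r hr]
    congr 1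
    refine integral_congr fun s hs => ?_
    rw [uIcc_of_le hr] at hs
    simp only [max_eq_right hs.1]
  exact hd.congr heq (heq t ht)

/-- conservation of trip-miles. If `K` satisfies the K-model PDE and
suitable integrability/domination conditions hold, then the remaining trip-miles
`M(t) = ∫₀^∞ K(t,x) dx` is differentiable with `M'(t) = f(t)·B̃(t) - v(t)·K(t,0)`;
equivalently `M(t) = M(0) + ∫₀ᵗ f·B̃ - ∫₀ᵗ λ·v` with `λ(s) = K(s,0)`. -/
theorem conservation_of_trip_miles
    (v f Bt : ℝ → ℝ) (Φt K : ℝ → ℝ → ℝ)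
    (hv : Continuous v) (hf : Continuous f)
    (hK : ContDiff ℝ 1 (Function.uncurry K))
    (hPDE : ∀ t ≥ (0:ℝ), ∀ x ≥ (0:ℝ),
      deriv (fun s => K s x) t - v t * deriv (fun y => K t y) x = f t * Φt t x)
    (hKint : ∀ t ≥ (0:ℝ), IntegrableOn (K t) (Ici 0))
    (hKlim : ∀ t ≥ (0:ℝ), Tendsto (K t) atTop (nhds 0))
    (hΦtint : ∀ t ≥ (0:ℝ), IntegrableOn (Φt t) (Ici 0))
    (hBt : ∀ t ≥ (0:ℝ), Bt t = ∫ x in Ici (0:ℝ), Φt t x)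
    (hBtcont : ContinuousOn Bt (Ici 0))
    (hdom : ∀ a b : ℝ, 0 ≤ a → a ≤ b → ∃ g : ℝ → ℝ, IntegrableOn g (Ici 0) ∧
      ∀ t ∈ Icc a b, ∀ x ≥ (0:ℝ), |deriv (fun s => K s x) t| ≤ g x) :
    (∀ t ≥ (0:ℝ), HasDerivWithinAt (fun s => ∫ x in Ici (0:ℝ), K s x)
      (f t * Bt t - v t * K t 0) (Ici 0) t) ∧
    (∀ t ≥ (0:ℝ), (∫ x in Ici (0:ℝ), K t x) = (∫ x in Ici (0:ℝ), K 0 x)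
      + (∫ s in (0:ℝ)..t, f s * Bt s) - ∫ s in (0:ℝ)..t, K s 0 * v s) := by
  have hDint : ∀ t ≥ (0:ℝ), IntegrableOn (fun x => deriv (fun s => K s x) t) (Ici 0) := by
    intro t ht
    obtain ⟨g, hg, hbound⟩ := hdom t t ht le_rfl
    refine hg.mono' ((continuous_deriv_fst_of_contDiff hK).comp
      (Continuous.prodMk_right t)).aestronglyMeasurable ?_
    filter_upwards [ae_restrict_mem measurableSet_Ici] with x hx
    exact hbound t (left_mem_Icc.2 le_rfl) x hx
  have hrate : ∀ t ≥ (0:ℝ), ∫ x in Ici (0:ℝ), deriv (fun s => K s x) t =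
      f t * Bt t - v t * K t 0 := by
    intro t ht
    rw [hBt t ht, ← MeasureTheory.integral_const_mul]
    exact integral_eq_of_sub_mul_deriv_eq
      (fun x => (hasDerivAt_snd_of_contDiff hK t x).differentiableAt) (hKlim t ht)
      (hDint t ht) ((hΦtint t ht).const_mul (f t)) (hPDE t ht)
  have hin : ContinuousOn (fun s => f s * Bt s) (Ici 0) := hf.continuousOn.mul hBtcont
  have hK0 : Continuous fun s => K s 0 := hK.continuous.comp (Continuous.prodMk_left 0)
  have hout : Continuous fun s => v s * K s 0 := hv.mul hK0
  have hM : ∀ t ≥ (0:ℝ), (∫ x in Ici (0:ℝ), K t x) = (∫ x in Ici (0:ℝ), K 0 x) +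
      ∫ s in (0:ℝ)..t, (f s * Bt s - v s * K s 0) := by
    intro t ht
    obtain ⟨g, hg, hbound⟩ := hdom 0 t le_rfl ht
    have hsub := integral_sub_integral_eq_of_dominated ht hK (hKint 0 le_rfl) (hKint t ht)
      hg hbound
    have hcongr : ∫ s in (0:ℝ)..t, (∫ x in Ici (0:ℝ), deriv (fun r => K r x) s) =
        ∫ s in (0:ℝ)..t, (f s * Bt s - v s * K s 0) :=
      integral_congr fun s hs => hrate s (by rw [uIcc_of_le ht] at hs; exact hs.1)
    linarith
  refine ⟨fun t ht => hasDerivWithinAt_Ici_of_eq_add_integral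
    (M := fun s => ∫ x in Ici (0:ℝ), K s x) (hin.sub hout.continuousOn) hM ht, fun t ht => ?_⟩
  have hin_t : IntervalIntegrable (fun s => f s * Bt s) volume 0 t :=
    (hin.mono (by rw [uIcc_of_le ht]; exact Icc_subset_Ici_self)).intervalIntegrable
  rw [hM t ht, intervalIntegral.integral_sub hin_t (hout.intervalIntegrable 0 t)]
  simp only [mul_comm (v _)]
  ring
end

section
/- Let k : [0,∞) × [0,∞) → ℝ be continuously differentiable and satisfy the k-model PDE ∂k/∂t(t,x) − v(t)·∂k/∂x(t,x) = f(t)·φ̃(t,x) for all t ≥ 0, x ≥ 0, with v, f continuous. Assume for each t that k(t,·) and φ̃(t,·) are integrable on [0,∞) with k(t,y) → 0 as y → ∞, and that for every compact time interval there is an integrable function of y dominating |∂k/∂t(t,y)| on that interval. Define K(t,x) = ∫ₓ^∞ k(t,y) dy and Φ̃(t,x) = ∫ₓ^∞ φ̃(t,y) dy. Then K satisfies the K-model PDE: ∂K/∂t(t,x) − v(t)·∂K/∂x(t,x) = f(t)·Φ̃(t,x) for all t ≥ 0 and x ≥ 0. -/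
open MeasureTheory Set Filter intervalIntegral

/-- Differentiation under the integral sign, with derivatives taken within an interval. -/
theorem hasDerivWithinAt_setIntegral_of_dominated {k k' : ℝ → ℝ → ℝ} {g : ℝ → ℝ} {S I J : Set ℝ}
    {t : ℝ} (hS : MeasurableSet S) (hJ : Convex ℝ J) (htJ : t ∈ J) (hJI : J ∈ nhdsWithin t I)
    (hderiv : ∀ s ∈ J, ∀ y ∈ S, HasDerivAt (fun r => k r y) (k' s y) s)
    (hint : ∀ s ∈ J, IntegrableOn (k s) S) (hg : IntegrableOn g S)
    (hbound : ∀ s ∈ J, ∀ y ∈ S, |k' s y| ≤ g y) :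
    HasDerivWithinAt (fun s => ∫ y in S, k s y) (∫ y in S, k' t y) I t := by
  rw [hasDerivWithinAt_iff_tendsto_slope]
  have hJ' : ∀ᶠ s in nhdsWithin t (I \ {t}), s ∈ J := nhdsWithin_mono t sdiff_subset hJI
  have hslope : Tendsto (fun s => ∫ y in S, slope (fun r => k r y) t s)
      (nhdsWithin t (I \ {t})) (nhds (∫ y in S, k' t y)) := by
    refine tendsto_integral_filter_of_dominated_convergence g ?_ ?_ hg ?_
    · filter_upwards [hJ'] with s hs
      simp only [slope_def_field]
      exact (((hint s hs).sub (hint t htJ)).div_const (s - t)).aestronglyMeasurable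
    · filter_upwards [hJ', self_mem_nhdsWithin] with s hs hst
      refine (ae_restrict_mem hS).mono fun y hy => ?_
      have hne : 0 < |s - t| := abs_pos.2 (sub_ne_zero.2 hst.2)
      have hle := hJ.norm_image_sub_le_of_norm_hasDerivWithin_le
        (fun r hr => (hderiv r hr y hy).hasDerivWithinAt)
        (fun r hr => hbound r hr y hy) htJ hs
      rw [slope_def_field, Real.norm_eq_abs, abs_div, div_le_iff₀ hne]
      exact hle
    · refine (ae_restrict_mem hS).mono fun y hy => ?_
      exact hasDerivWithinAt_iff_tendsto_slope.1 (hderiv t htJ y hy).hasDerivWithinAt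
  refine hslope.congr' ?_
  filter_upwards [hJ'] with s hs
  simp only [slope_def_field]
  rw [MeasureTheory.integral_div, MeasureTheory.integral_sub (hint s hs) (hint t htJ)]

/-- The tail integral of a continuous integrable function has derivative minus the function. -/
theorem hasDerivWithinAt_integral_Ici {h : ℝ → ℝ} {a x : ℝ} (hc : Continuous h)
    (hint : IntegrableOn h (Ici a)) (hx : a ≤ x) :
    HasDerivWithinAt (fun z => ∫ y in Ici z, h y) (-h x) (Ici a) x := by
  have hd : HasDerivAt (fun z => (∫ y in Ici a, h y) - ∫ y in a..z, h y) (-h x) x :=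
    (hc.integral_hasStrictDerivAt a x).hasDerivAt.const_sub _
  refine hd.hasDerivWithinAt.congr_of_mem (fun z hz => ?_) hx
  have hsub := integral_Ioi_sub_Ioi (hint.mono_set Ioi_subset_Ici_self) hz
  simp only [integral_Ici_eq_integral_Ioi]
  linarith

/-- from the k-model to the K-model. If the density `k` satisfies
`∂k/∂t - v(t)·∂k/∂x = f(t)·φ̃(t,x)` with suitable integrability/domination, then
`K(t,x) = ∫ₓ^∞ k(t,y) dy` satisfies the K-model PDE
`∂K/∂t - v(t)·∂K/∂x = f(t)·Φ̃(t,x)` with `Φ̃(t,x) = ∫ₓ^∞ φ̃(t,y) dy`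
(partial derivatives taken within the quadrant `t ≥ 0`, `x ≥ 0`). -/
theorem k_model_implies_K_model
    (v f : ℝ → ℝ) (φt k : ℝ → ℝ → ℝ)
    (hv : Continuous v) (hf : Continuous f)
    (hk : ContDiff ℝ 1 (Function.uncurry k))
    (hPDE : ∀ t ≥ (0:ℝ), ∀ x ≥ (0:ℝ),
      deriv (fun s => k s x) t - v t * deriv (fun y => k t y) x = f t * φt t x)
    (hkint : ∀ t ≥ (0:ℝ), IntegrableOn (k t) (Ici 0))
    (hφtint : ∀ t ≥ (0:ℝ), IntegrableOn (φt t) (Ici 0))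
    (hklim : ∀ t ≥ (0:ℝ), Tendsto (k t) atTop (nhds 0))
    (hdom : ∀ a b : ℝ, 0 ≤ a → a ≤ b → ∃ g : ℝ → ℝ, IntegrableOn g (Ici 0) ∧
      ∀ t ∈ Icc a b, ∀ y ≥ (0:ℝ), |deriv (fun s => k s y) t| ≤ g y) :
    ∀ t ≥ (0:ℝ), ∀ x ≥ (0:ℝ),
      derivWithin (fun s => ∫ y in Ici x, k s y) (Ici 0) t
        - v t * derivWithin (fun x' => ∫ y in Ici x', k t y) (Ici 0) x
      = f t * ∫ y in Ici x, φt t y := by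
  intro t ht x hx
  have hdiff : Differentiable ℝ (Function.uncurry k) := hk.differentiable one_ne_zero
  have htime : ∀ s y, HasDerivAt (fun r => k r y) (deriv (fun r => k r y) s) s := fun s y =>
    DifferentiableAt.hasDerivAt (hdiff.comp (g := Function.uncurry k) (f := fun r => (r, y))
      (by fun_prop) s)
  have hspace : ∀ s y, HasDerivAt (k s) (deriv (k s) y) y := fun s y =>
    DifferentiableAt.hasDerivAt (hdiff.comp (g := Function.uncurry k) (f := fun z => (s, z))
      (by fun_prop) y)
  have hcont : Continuous (k t) := continuous_iff_continuousAt.2 fun y => (hspace t y).continuousAt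
  have htime_cont : Continuous (fun y => deriv (fun r => k r y) t) := by
    have heq : (fun y => deriv (fun r => k r y) t)
        = fun y => fderiv ℝ (Function.uncurry k) (t, y) (1, 0) := by
      funext y
      exact ((hdiff (t, y)).hasFDerivAt.comp_hasDerivAt t
        ((hasDerivAt_id t).prodMk (hasDerivAt_const t y))).deriv
    rw [heq]
    exact ((hk.continuous_fderiv one_ne_zero).comp (by fun_prop)).clm_apply continuous_const
  have hsub : Ici x ⊆ Ici (0 : ℝ) := Ici_subset_Ici.2 hx
  obtain ⟨g, hg, hbound⟩ := hdom 0 (t + 1) le_rfl (by linarith)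
  have hJ : Icc 0 (t + 1) ∈ nhdsWithin t (Ici 0) := by
    rw [← Ici_inter_Iic]
    exact inter_mem self_mem_nhdsWithin (mem_nhdsWithin_of_mem_nhds (Iic_mem_nhds (by linarith)))
  have htJ : t ∈ Icc 0 (t + 1) := ⟨ht, by linarith⟩
  have hKt := hasDerivWithinAt_setIntegral_of_dominated (S := Ici x) measurableSet_Ici
    (convex_Icc 0 (t + 1)) htJ hJ (fun s _ y _ => htime s y)
    (fun s hs => (hkint s hs.1).mono_set hsub) (hg.mono_set hsub)
    (fun s hs y hy => hbound s hs y (hsub hy))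
  have hKx := hasDerivWithinAt_integral_Ici hcont (hkint t ht) hx
  rw [hKt.derivWithin (uniqueDiffOn_Ici 0 t ht), hKx.derivWithin (uniqueDiffOn_Ici 0 x hx)]
  have htime_int : IntegrableOn (fun y => deriv (fun r => k r y) t) (Ici x) :=
    (hg.mono_set hsub).mono' htime_cont.aestronglyMeasurable
      ((ae_restrict_mem measurableSet_Ici).mono fun y hy => hbound t htJ y (hsub hy))
  have hsource_int : IntegrableOn (fun y => f t * φt t y) (Ici x) :=
    ((hφtint t ht).mono_set hsub).const_mul (f t)
  have hflux : EqOn (fun y => deriv (fun r => k r y) t - f t * φt t y)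
      (fun y => v t * deriv (k t) y) (Ici x) := fun y hy => by
    have := hPDE t ht y (hsub hy)
    simp only
    linarith
  have hflux_int : IntegrableOn (fun y => v t * deriv (k t) y) (Ici x) :=
    (htime_int.sub hsource_int).congr_fun hflux measurableSet_Ici
  have hftc : ∫ y in Ioi x, v t * deriv (k t) y = v t * 0 - v t * k t x :=
    integral_Ioi_of_hasDerivAt_of_tendsto' (fun y _ => (hspace t y).const_mul (v t))
      (hflux_int.mono_set Ioi_subset_Ici_self) ((hklim t ht).const_mul (v t))
  have hbalance := setIntegral_congr_fun (μ := volume) measurableSet_Ici hflux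
  rw [MeasureTheory.integral_sub htime_int hsource_int, MeasureTheory.integral_const_mul,
    integral_Ici_eq_integral_Ioi (f := fun y => v t * deriv (k t) y), hftc] at hbalance
  linarith
end

section
/- Let λ : [0,∞) → (0,∞) be differentiable, v, f : [0,∞) → ℝ, and let φ : [0,∞) × [0,∞) → ℝ be continuously differentiable. Suppose λ and φ satisfy the φ-model: λ′(t) = f(t) − φ(t,0)·λ(t)·v(t) and ∂φ/∂t(t,x) − v(t)·∂φ/∂x(t,x) = (f(t)/λ(t))·(φ̃(t,x) − φ(t,x)) + φ(t,x)·φ(t,0)·v(t) for all t ≥ 0, x ≥ 0. Then k(t,x) = λ(t)·φ(t,x) satisfies the k-model PDE: ∂k/∂t(t,x) − v(t)·∂k/∂x(t,x) = f(t)·φ̃(t,x) for all t ≥ 0 and x ≥ 0. -/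
open MeasureTheory Set Filter

/-- the φ-model implies the k-model. If `λ` and `φ` satisfy
`λ'(t) = f(t) - φ(t,0)·λ(t)·v(t)` and
`∂φ/∂t - v(t)·∂φ/∂x = (f(t)/λ(t))·(φ̃(t,x) - φ(t,x)) + φ(t,x)·φ(t,0)·v(t)`,
then `k(t,x) = λ(t)·φ(t,x)` satisfies
`∂k/∂t - v(t)·∂k/∂x = f(t)·φ̃(t,x)`. -/
theorem phi_model_implies_k_model
    (lam v f : ℝ → ℝ) (φ φt : ℝ → ℝ → ℝ)
    (hlam_pos : ∀ t ≥ (0:ℝ), 0 < lam t)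
    (hlam_diff : ∀ t ≥ (0:ℝ), DifferentiableAt ℝ lam t)
    (hφ_smooth : ContDiff ℝ 1 (Function.uncurry φ))
    (hODE : ∀ t ≥ (0:ℝ), deriv lam t = f t - φ t 0 * lam t * v t)
    (hPDE : ∀ t ≥ (0:ℝ), ∀ x ≥ (0:ℝ),
      deriv (fun s => φ s x) t - v t * deriv (φ t) x
        = f t / lam t * (φt t x - φ t x) + φ t x * φ t 0 * v t) :
    ∀ t ≥ (0:ℝ), ∀ x ≥ (0:ℝ),
      deriv (fun s => lam s * φ s x) t - v t * deriv (fun y => lam t * φ t y) x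
        = f t * φt t x := by
  intro t ht x hx
  have hφ : DifferentiableAt ℝ (fun s => φ s x) t := by
    have h : Differentiable ℝ (fun s => Function.uncurry φ (s, x)) :=
      (hφ_smooth.differentiable one_ne_zero).comp (by fun_prop)
    exact h t
  have hne : lam t ≠ 0 := (hlam_pos t ht).ne'
  have hprod : deriv (fun s => lam s * φ s x) t
      = deriv lam t * φ t x + lam t * deriv (fun s => φ s x) t :=
    deriv_fun_mul (hlam_diff t ht) hφ
  have hscale : deriv (fun y => lam t * φ t y) x = lam t * deriv (φ t) x :=
    deriv_const_mul_field (lam t)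
  have hdiv : lam t * (f t / lam t) = f t := mul_div_cancel₀ (f t) hne
  rw [hprod, hscale, hODE t ht]
  linear_combination lam t * hPDE t ht x hx + (φt t x - φ t x) * hdiv
end

section
/- Let v : [0,∞) → (0,∞) be continuous, z(t) = ∫₀ᵗ v(s) ds with z(t) → ∞ as t → ∞, and let τ : [0,∞) → [0,∞) be the inverse function of z. Fix t ≥ 0, and let φ̃(t,·) : [0,∞) → [0,∞) be measurable with Φ̃(t,x) = ∫ₓ^∞ φ̃(t,y) dy < ∞ for all x ≥ 0. Define the travel time of a trip entering at t with distance x by Υ(t,x) = τ(x + z(t)) − t. Then the average travel time satisfies ∫₀^∞ Υ(t,x)·φ̃(t,x) dx = ∫₀^∞ Φ̃(t,x)·(1 / v(τ(x + z(t)))) dx, as an identity in [0,∞]. -/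
open MeasureTheory Set Filter intervalIntegral

/-- A monotone self-map of `[0, ∞)` that is onto is continuous there. -/
lemma continuousOn_Ici_of_monotoneOn_of_surjOn {τ : ℝ → ℝ} (hmono : MonotoneOn τ (Ici 0))
    (hmaps : MapsTo τ (Ici 0) (Ici 0)) (hsurj : SurjOn τ (Ici 0) (Ici 0)) :
    ContinuousOn τ (Ici 0) := by
  have h : Continuous (hmaps.restrict τ (Ici 0) (Ici 0)) := by
    refine Monotone.continuous_of_surjective (fun a b hab => ?_) ?_
    · exact hmono a.2 b.2 hab
    · exact (MapsTo.restrict_surjective_iff hmaps).2 hsurj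
  exact continuousOn_iff_continuous_domRestrict.2 (continuous_subtype_val.comp h)

/-- The primitive of a positive continuous function is strictly increasing on `[0, ∞)`. -/
lemma strictMonoOn_Ici_of_hasDerivAt_pos {z v : ℝ → ℝ} (hz : ∀ s, HasDerivAt z (v s) s)
    (hv : ∀ s ≥ (0 : ℝ), 0 < v s) : StrictMonoOn z (Ici 0) := by
  refine strictMonoOn_of_deriv_pos (convex_Ici 0)
    (fun s _ => (hz s).continuousAt.continuousWithinAt) fun s hs => ?_
  rw [(hz s).deriv]
  exact hv s (interior_subset hs)

/-- Fubini for a density on `[0, ∞)`: the mean of a primitive is the integral of its derivative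
against the tail of the density. -/
lemma lintegral_ofReal_intervalIntegral_mul_eq_lintegral_tail_mul {φ g : ℝ → ℝ}
    (hφ : Measurable φ) (hφ_nn : ∀ x ≥ (0 : ℝ), 0 ≤ φ x)
    (hφ_int : ∀ x ≥ (0 : ℝ), IntegrableOn φ (Ici x))
    (hg : ContinuousOn g (Ici 0)) (hg_nn : ∀ x ≥ (0 : ℝ), 0 ≤ g x) :
    (∫⁻ x in Ici (0 : ℝ), ENNReal.ofReal ((∫ y in (0 : ℝ)..x, g y) * φ x))
      = ∫⁻ x in Ici (0 : ℝ), ENNReal.ofReal ((∫ y in Ici x, φ y) * g x) := by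
  set μ : Measure ℝ := (volume.restrict (Ici 0)).withDensity fun x => ENNReal.ofReal (φ x) with hμ
  have hg_int : ∀ x ≥ (0 : ℝ), IntervalIntegrable g volume 0 x := fun x hx =>
    (hg.mono (by rw [uIcc_of_le hx]; exact Icc_subset_Ici_self)).intervalIntegrable
  have hac : μ ≪ volume.restrict (Ici 0) := withDensity_absolutelyContinuous _ _
  have hlayer := lintegral_comp_eq_lintegral_meas_le_mul μ (f := id) (g := g)
    (hac.ae_le (ae_restrict_mem measurableSet_Ici)) aemeasurable_id
    (fun x hx => hg_int x (le_of_lt hx))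
    ((ae_restrict_mem measurableSet_Ioi).mono fun x hx => hg_nn x (le_of_lt hx))
  have hleft : (∫⁻ x, ENNReal.ofReal (∫ y in (0 : ℝ)..id x, g y) ∂μ)
      = ∫⁻ x in Ici (0 : ℝ), ENNReal.ofReal ((∫ y in (0 : ℝ)..x, g y) * φ x) := by
    rw [hμ, lintegral_withDensity_eq_lintegral_mul_non_measurable _ hφ.ennreal_ofReal
      (ae_of_all _ fun _ => ENNReal.ofReal_lt_top)]
    refine setLIntegral_congr_fun measurableSet_Ici fun x hx => ?_
    simp only [Pi.mul_apply, id]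
    rw [mul_comm (ENNReal.ofReal (φ x)), ENNReal.ofReal_mul' (hφ_nn x hx)]
  rw [← hleft, hlayer, setLIntegral_congr Ioi_ae_eq_Ici]
  refine setLIntegral_congr_fun measurableSet_Ici fun x hx => ?_
  have hset : {a : ℝ | x ≤ id a} = Ici x := rfl
  have hsub : Ici x ⊆ Ici (0 : ℝ) := Ici_subset_Ici.2 hx
  rw [ENNReal.ofReal_mul' (hg_nn x hx), hset, hμ, withDensity_apply _ measurableSet_Ici,
    Measure.restrict_restrict measurableSet_Ici, inter_eq_left.2 hsub,
    ofReal_integral_eq_lintegral_ofReal (hφ_int x hx)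
      ((ae_restrict_mem measurableSet_Ici).mono fun y hy => hφ_nn y (hsub hy))]

/-- average travel time identity. With speed `v > 0`, cumulative
travel distance `z(t) = ∫₀ᵗ v`, inverse `τ` of `z`, travel time
`Υ(t,x) = τ(x + z(t)) - t`, entering-distance density `φ̃` and
`Φ̃(x) = ∫ₓ^∞ φ̃(y) dy`, one has
`∫₀^∞ Υ(t,x)·φ̃(x) dx = ∫₀^∞ Φ̃(x)·(1/v(τ(x+z(t)))) dx` as an identity in `[0,∞]`. -/
theorem average_travel_time_identity
    (v z τ : ℝ → ℝ) (hv : Continuous v) (hvpos : ∀ t ≥ (0:ℝ), 0 < v t)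
    (hz : ∀ t, z t = ∫ s in (0:ℝ)..t, v s)
    (hzto : Tendsto z atTop atTop)
    (hτnn : ∀ y ≥ (0:ℝ), 0 ≤ τ y)
    (hτz : ∀ t ≥ (0:ℝ), τ (z t) = t)
    (hzτ : ∀ y ≥ (0:ℝ), z (τ y) = y)
    (t : ℝ) (ht : 0 ≤ t)
    (φt Φt : ℝ → ℝ)
    (hφt_meas : Measurable φt) (hφt_nn : ∀ x ≥ (0:ℝ), 0 ≤ φt x)
    (hφt_int : ∀ x ≥ (0:ℝ), IntegrableOn φt (Ici x))
    (hΦt : ∀ x ≥ (0:ℝ), Φt x = ∫ y in Ici x, φt y) :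
    (∫⁻ x in Ici (0:ℝ), ENNReal.ofReal ((τ (x + z t) - t) * φt x))
      = ∫⁻ x in Ici (0:ℝ), ENNReal.ofReal (Φt x * (1 / v (τ (x + z t)))) := by
  have hz' : ∀ s, HasDerivAt z (v s) s := by
    rw [funext hz]
    exact fun s => hv.integral_hasStrictDerivAt 0 s |>.hasDerivAt
  have hzmono := strictMonoOn_Ici_of_hasDerivAt_pos hz' hvpos
  have hz_nn : ∀ s ≥ (0 : ℝ), 0 ≤ z s := fun s hs => by
    simpa [hz 0] using hzmono.monotoneOn self_mem_Ici hs hs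
  have hτcont : ContinuousOn τ (Ici 0) := by
    refine continuousOn_Ici_of_monotoneOn_of_surjOn (fun a ha b hb hab => ?_) hτnn
      fun s hs => ⟨z s, hz_nn s hs, hτz s hs⟩
    rwa [← hzmono.le_iff_le (hτnn a ha) (hτnn b hb), hzτ a ha, hzτ b hb]
  have hshift : MapsTo (fun x => x + z t) (Ici 0) (Ici 0) := fun x hx =>
    add_nonneg hx (hz_nn t ht)
  have hΥcont : ContinuousOn (fun x => τ (x + z t)) (Ici 0) :=
    hτcont.comp (by fun_prop) hshift
  have hgcont : ContinuousOn (fun x => 1 / v (τ (x + z t))) (Ici 0) :=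
    continuousOn_const.div (hv.comp_continuousOn hΥcont) fun x hx =>
      (hvpos _ (hτnn _ (hshift hx))).ne'
  have hprim : ∀ x ≥ (0 : ℝ), ∫ y in (0 : ℝ)..x, 1 / v (τ (y + z t)) = τ (x + z t) - t := by
    intro x hx
    rw [integral_eq_sub_of_hasDerivAt_of_le hx (f := fun y => τ (y + z t))
      (hΥcont.mono Icc_subset_Ici_self) (fun y hy => ?_)
      (hgcont.mono (by rw [uIcc_of_le hx]; exact Icc_subset_Ici_self)).intervalIntegrable]
    · simp [hτz t ht]
    · have hpos : 0 < y + z t := add_pos_of_pos_of_nonneg hy.1 (hz_nn t ht)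
      have hderiv : HasDerivAt τ (v (τ (y + z t)))⁻¹ (y + z t) :=
        (hz' _).of_local_left_inverse (hτcont.continuousAt (Ici_mem_nhds hpos))
          (hvpos _ (hτnn _ hpos.le)).ne' (Filter.Eventually.mono (Ici_mem_nhds hpos) fun w hw => hzτ w hw)
      simpa only [one_div] using hderiv.comp_add_const y (z t)
  have key := lintegral_ofReal_intervalIntegral_mul_eq_lintegral_tail_mul hφt_meas hφt_nn hφt_int
    hgcont fun x hx => one_div_nonneg.2 (hvpos _ (hτnn _ (hshift hx))).le
  refine Eq.trans ?_ (key.trans ?_)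
  · exact setLIntegral_congr_fun measurableSet_Ici fun x hx => by simp only [hprim x hx]
  · exact setLIntegral_congr_fun measurableSet_Ici fun x hx => by simp only [hΦt x hx]
end

section
/- Let v : [0,∞) → (0,∞) and f : [0,∞) → [0,∞) be continuous (as functions of the cumulative travel distance z), let B̃ : [0,∞) → [0,∞) be differentiable with dB̃/dz > −1, so the effective distance θ(z) = B̃(z) + z is strictly increasing and continuous with θ(z) ≥ z and θ(0) = B̃(0), let F(z) = ∫₀ᶻ f(y)/v(y) dy, and let K(0,·) describe the initial trips. Then the number of active trips given by the integral form λ(z) = K(0,z) + ∫₀ᶻ (f(y)/v(y))·H(θ(y) − z) dy, with H the Heaviside function (H(s) = 1 for s ≥ 0 and 0 for s < 0), satisfies: λ(z) = K(0,z) + F(z) for z < B̃(0), and λ(z) = K(0,z) + F(z) − F(θ⁻¹(z)) for z ≥ B̃(0) in the range of θ; i.e., entering trips exit in first-in-first-out order, and exactly those entering before θ⁻¹(z) have exited by z. -/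
open MeasureTheory Set Filter intervalIntegral

/-- The Heaviside function: `H(s) = 1` for `s ≥ 0` and `0` for `s < 0`. -/
noncomputable def heaviside (s : ℝ) : ℝ := if 0 ≤ s then 1 else 0

theorem heaviside_of_nonneg {s : ℝ} (hs : 0 ≤ s) : heaviside s = 1 := if_pos hs

theorem heaviside_of_neg {s : ℝ} (hs : s < 0) : heaviside s = 0 := if_neg hs.not_ge

/-- If `θ` is below `z` on `(a, w)` and at least `z` on `(w, b)`, then the factor `H(θ(y) - z)`
restricts an integral over `[a, b]` to `[w, b]`. -/
theorem integral_mul_heaviside_eq {g θ : ℝ → ℝ} {a w b z : ℝ} (haw : a ≤ w) (hwb : w ≤ b)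
    (hg : IntervalIntegrable g volume w b)
    (hlt : ∀ y ∈ Ioo a w, θ y < z) (hge : ∀ y ∈ Ioo w b, z ≤ θ y) :
    ∫ y in a..b, g y * heaviside (θ y - z) = ∫ y in w..b, g y := by
  have h_zero : EqOn (fun _ => (0 : ℝ)) (fun y => g y * heaviside (θ y - z)) (Ioo a w) :=
    fun y hy => by simp [heaviside_of_neg (sub_neg.2 (hlt y hy))]
  have h_eq : EqOn g (fun y => g y * heaviside (θ y - z)) (Ioo w b) :=
    fun y hy => by simp [heaviside_of_nonneg (sub_nonneg.2 (hge y hy))]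
  rw [← integral_add_adjacent_intervals
      (IntervalIntegrable.congr_uIoo intervalIntegrable_const (uIoo_of_le haw ▸ h_zero))
      (hg.congr_uIoo (uIoo_of_le hwb ▸ h_eq)),
    ← integral_congr_Ioo_of_le haw h_zero, ← integral_congr_Ioo_of_le hwb h_eq]
  simp

/-- deterministic trip distances with `dB̃/dz > -1` (first-in-first-out
case), so `θ(z) = B̃(z) + z` is strictly increasing and continuous with `θ(z) ≥ z`.
Then `λ(z) = K(0,z) + ∫₀ᶻ (f/v)·H(θ(y) - z) dy` satisfies `λ(z) = K(0,z) + F(z)`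
for `z < B̃(0)`, and `λ(z) = K(0,z) + F(z) - F(θ⁻¹(z))` for `z ≥ B̃(0)` in the
range of `θ`. -/
theorem fifo_deterministic_trip_distances
    (v f Bt Bt' F lam K0 : ℝ → ℝ)
    (hv : Continuous v) (hvpos : ∀ z ≥ (0:ℝ), 0 < v z)
    (hf : Continuous f) (hfnn : ∀ z ≥ (0:ℝ), 0 ≤ f z)
    (hBtnn : ∀ z ≥ (0:ℝ), 0 ≤ Bt z)
    (hBtderiv : ∀ z ≥ (0:ℝ), HasDerivWithinAt Bt (Bt' z) (Ici 0) z)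
    (hBt' : ∀ z ≥ (0:ℝ), -1 < Bt' z)
    (hθmono : StrictMonoOn (fun z => Bt z + z) (Ici 0))
    (hθcont : ContinuousOn (fun z => Bt z + z) (Ici 0))
    (hθge : ∀ z ≥ (0:ℝ), z ≤ Bt z + z)
    (hF : ∀ z ≥ (0:ℝ), F z = ∫ y in (0:ℝ)..z, f y / v y)
    (hlam : ∀ z ≥ (0:ℝ),
      lam z = K0 z + ∫ y in (0:ℝ)..z, f y / v y * heaviside (Bt y + y - z)) :
    (∀ z ≥ (0:ℝ), z < Bt 0 → lam z = K0 z + F z) ∧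
    (∀ z ≥ Bt 0, ∀ w ≥ (0:ℝ), Bt w + w = z → lam z = K0 z + F z - F w) := by
  have hint : ∀ a ≥ (0:ℝ), ∀ b ≥ a, IntervalIntegrable (fun y => f y / v y) volume a b := by
    intro a ha b hab
    refine (hf.continuousOn.div hv.continuousOn fun y hy => ?_).intervalIntegrable
    rw [uIcc_of_le hab] at hy
    exact (hvpos y (ha.trans hy.1)).ne'
  refine ⟨fun z hz hzB => ?_, fun z _ w hw hwz => ?_⟩
  · rw [hlam z hz, hF z hz,
      integral_mul_heaviside_eq (θ := fun y => Bt y + y) le_rfl hz (hint 0 le_rfl z hz)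
        (by simp) fun y hy => ?_]
    have := hθmono.monotoneOn self_mem_Ici (mem_Ici.2 hy.1.le) hy.1.le
    simp only [add_zero] at this
    exact hzB.le.trans this
  · have hwz' : w ≤ z := hwz ▸ hθge w hw
    have hz : 0 ≤ z := hw.trans hwz'
    rw [hlam z hz, hF z hz, hF w hw,
      integral_mul_heaviside_eq (θ := fun y => Bt y + y) hw hwz' (hint w hw z hwz')
        (fun y hy => hwz ▸ hθmono (mem_Ici.2 hy.1.le) (mem_Ici.2 hw) hy.2)
        (fun y hy => hwz ▸ hθmono.monotoneOn (mem_Ici.2 hw) (mem_Ici.2 (hw.trans hy.1.le)) hy.1.le),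
      ← integral_add_adjacent_intervals (hint 0 le_rfl w hw) (hint w hw z hwz')]
    ring
end

section
/- Let B̃ > 0, f > 0, v > 0 be constants, and let K : [0,∞) → ℝ be continuous, differentiable on (0,B̃) ∪ (B̃,∞), with K(x) = 0 for all x ≥ B̃, and satisfying the stationary K-model with constant trip distances: −v·K′(x) = f for 0 < x < B̃ and K′(x) = 0 for x > B̃. Then K(x) = (f/v)·(B̃ − x) for x ∈ [0,B̃]; consequently the number of active trips is λ = K(0) = f·B̃/v (so the stationary out-flux equals g = f = (1/B̃)·λ·v), and the remaining-distance distribution Φ(x) = K(x)/λ = max(1 − x/B̃, 0) is the uniform distribution on [0,B̃] with density 1/B̃. -/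
open MeasureTheory Set Filter

/-- the stationary K-model with constant trip distances `B̃`,
constant in-flux `f` and constant speed `v`: `-v·K'(x) = f` on `(0,B̃)`,
`K ≡ 0` on `[B̃,∞)`. Then `K(x) = (f/v)·(B̃ - x)` on `[0,B̃]`, the number of active
trips is `λ = K(0) = f·B̃/v` (so the stationary out-flux is `g = f = (1/B̃)·λ·v`),
and `Φ(x) = K(x)/λ = max(1 - x/B̃, 0)` is the uniform distribution on `[0,B̃]`. -/
theorem stationary_constant_trip_distances
    (Bt f v : ℝ) (hBt : 0 < Bt) (hf : 0 < f) (hv : 0 < v)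
    (K : ℝ → ℝ)
    (hKcont : ContinuousOn K (Ici 0))
    (hKdiff1 : ∀ x ∈ Ioo 0 Bt, DifferentiableAt ℝ K x)
    (hKdiff2 : ∀ x > Bt, DifferentiableAt ℝ K x)
    (hKzero : ∀ x ≥ Bt, K x = 0)
    (hODE1 : ∀ x ∈ Ioo 0 Bt, -v * deriv K x = f)
    (hODE2 : ∀ x > Bt, deriv K x = 0) :
    (∀ x ∈ Icc (0:ℝ) Bt, K x = f / v * (Bt - x)) ∧
    K 0 = f * Bt / v ∧
    f = 1 / Bt * (K 0 * v) ∧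
    (∀ x ≥ (0:ℝ), K x / K 0 = max (1 - x / Bt) 0) := by
  have hlin : ∀ x ∈ Icc (0:ℝ) Bt, K x = f / v * (Bt - x) := by
    rintro x ⟨hx0, hxB⟩
    rcases hxB.eq_or_lt with rfl | hlt
    · simp [hKzero x le_rfl]
    · obtain ⟨c, hc, hslope⟩ := exists_deriv_eq_slope K hlt
        (hKcont.mono fun y hy => hx0.trans hy.1)
        fun y hy => (hKdiff1 y ⟨hx0.trans_lt hy.1, hy.2⟩).differentiableWithinAt
      have hode := hODE1 c ⟨hx0.trans_lt hc.1, hc.2⟩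
      rw [hslope, hKzero Bt le_rfl] at hode
      have hne : Bt - x ≠ 0 := (sub_pos.2 hlt).ne'
      field_simp at hode ⊢
      linarith
  have hK0 : K 0 = f * Bt / v := by
    rw [hlin 0 ⟨le_rfl, hBt.le⟩]
    ring
  refine ⟨hlin, hK0, ?_, fun x hx => ?_⟩
  · rw [hK0]
    field_simp
  · rcases le_total x Bt with hxB | hxB
    · rw [max_eq_left (sub_nonneg.2 ((div_le_one hBt).2 hxB)), hK0, hlin x ⟨hx, hxB⟩]
      field_simp
    · rw [max_eq_right (sub_nonpos.2 ((one_le_div hBt).2 hxB)), hKzero x hxB, zero_div]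
end

section
/- Let B̃ > 0, L > 0, V : ℝ → ℝ, f : [0,∞) → ℝ continuous with F(t) = ∫₀ᵗ f(s) ds, and let K : [0,∞) × [0,B̃] → ℝ be continuously differentiable with K(t,B̃) = 0 for all t, satisfying the K-model with constant trip distances: ∂K/∂t(t,x) − V(K(t,0)/L)·∂K/∂x(t,x) = f(t) for all t ≥ 0 and 0 ≤ x < B̃. Define, for a constant N₀, the cumulative-flow function N(t,x) = N₀ + F(t) − K(t,x). Then N satisfies the nonlocal Hamilton–Jacobi equation ∂N/∂t(t,x) − V((N(t,B̃) − N(t,0))/L)·∂N/∂x(t,x) = 0 for all t ≥ 0 and 0 ≤ x < B̃, where N(t,B̃) − N(t,0) = K(t,0) is the number of active trips. -/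
open MeasureTheory Set Filter intervalIntegral

/-- the K-model with constant trip distances `B̃` is equivalent to a
nonlocal Hamilton–Jacobi equation for the cumulative-flow function
`N(t,x) = N₀ + F(t) - K(t,x)`: if `∂K/∂t - V(K(t,0)/L)·∂K/∂x = f(t)` on
`t ≥ 0`, `0 ≤ x < B̃` with `K(t,B̃) = 0`, then
`∂N/∂t - V((N(t,B̃) - N(t,0))/L)·∂N/∂x = 0`, and `N(t,B̃) - N(t,0) = K(t,0)` is
the number of active trips. -/
theorem nonlocal_hamilton_jacobi_formulation
    (Bt L N0 : ℝ) (hBt : 0 < Bt) (hL : 0 < L)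
    (V : ℝ → ℝ) (f F : ℝ → ℝ) (hf : Continuous f)
    (hF : ∀ t, F t = ∫ s in (0:ℝ)..t, f s)
    (K N : ℝ → ℝ → ℝ)
    (hK : ContDiff ℝ 1 (Function.uncurry K))
    (hKB : ∀ t ≥ (0:ℝ), K t Bt = 0)
    (hPDE : ∀ t ≥ (0:ℝ), ∀ x, 0 ≤ x → x < Bt →
      deriv (fun s => K s x) t - V (K t 0 / L) * deriv (fun y => K t y) x = f t)
    (hN : ∀ t x, N t x = N0 + F t - K t x) :
    (∀ t ≥ (0:ℝ), ∀ x, 0 ≤ x → x < Bt →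
      deriv (fun s => N s x) t
        - V ((N t Bt - N t 0) / L) * deriv (fun y => N t y) x = 0) ∧
    (∀ t ≥ (0:ℝ), N t Bt - N t 0 = K t 0) := by
  have hnum : ∀ t ≥ (0:ℝ), N t Bt - N t 0 = K t 0 := fun t ht => by
    rw [hN, hN, hKB t ht]
    ring
  refine ⟨fun t ht x hx hxB => ?_, hnum⟩
  have hKd : Differentiable ℝ (Function.uncurry K) := hK.differentiable one_ne_zero
  have hKt : DifferentiableAt ℝ (fun s => K s x) t :=
    (hKd (t, x)).comp t (f := fun s : ℝ => (s, x)) (by fun_prop)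
  have hFt : HasDerivAt F (f t) t := by
    rw [funext hF]
    exact integral_hasDerivAt_right (hf.intervalIntegrable 0 t)
      (hf.stronglyMeasurableAtFilter _ _) hf.continuousAt
  have hNt : deriv (fun s => N s x) t = f t - deriv (fun s => K s x) t := by
    simp_rw [hN]
    exact ((hFt.const_add N0).sub hKt.hasDerivAt).deriv
  have hNx : deriv (fun y => N t y) x = -deriv (fun y => K t y) x := by
    simp_rw [hN]
    exact deriv_const_sub _
  rw [hnum t ht, hNt, hNx, ← hPDE t ht x hx hxB]
  ring
end
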